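/- Let r ≥ 3 be an integer and let G be an n-vertex K_{r+1}-free simple graph with (r-1)·δ(G) + Δ(G) ≥ (r-1)·n. If u is a vertex of G with deg(u) = Δ(G), then the subgraph of G induced on the neighborhood N(u) is (r-1)-partite. -/

import Mathlib

namespace SimpleGraph

variable {V : Type*} {G : SimpleGraph V}

/-- A neighborhood in a `K_{n+1}`-free graph induces a `K_n`-free graph. -/
theorem CliqueFree.induce_neighborSet {n : ℕ} (hG : G.CliqueFree (n + 1)) (u : V) :
    (G.induce (G.neighborSet u)).CliqueFree n := by
  have h := CliqueFreeOn.of_succ G ((cliqueFreeOn_univ G).2 hG) (Set.mem_univ u)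
  rw [Set.univ_inter] at h
  exact (cliqueFree_induce_iff ..).2 h

/-- A vertex loses at most `|V| - |s|` neighbors when passing to the subgraph induced on `s`. -/
theorem degree_add_card_le_card_add_degree_induce [Fintype V] [DecidableRel G.Adj]
    (s : Set V) [DecidablePred (· ∈ s)] (v : s) :
    G.degree v + Fintype.card s ≤ Fintype.card V + (G.induce s).degree v := by
  classical
  have h : (G.induce s).degree v = (G.neighborFinset v ∩ s.toFinset).card := by
    rw [← card_neighborFinset_eq_degree, ← Finset.card_map (Function.Embedding.subtype (· ∈ s))]
    congr 1
    ext w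
    simp [and_comm]
  rw [h, ← card_neighborFinset_eq_degree, ← Set.toFinset_card, ← Finset.card_union_add_card_inter]
  gcongr
  exact Finset.card_le_univ _

end SimpleGraph


/-- Let `r ≥ 3` and let `G` be an `n`-vertex `K_{r+1}`-free simple graph with
`(r-1)·δ(G) + Δ(G) ≥ (r-1)·n`. If `u` is a vertex with `deg(u) = Δ(G)`, then the
subgraph induced on the neighborhood `N(u)` is `(r-1)`-partite. -/
theorem stmt_11 {V : Type*} [Fintype V] (r : ℕ) (hr : 3 ≤ r)
    (G : SimpleGraph V) [DecidableRel G.Adj]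
    (hfree : G.CliqueFree (r + 1))
    (hdeg : (r - 1) * Fintype.card V ≤ (r - 1) * G.minDegree + G.maxDegree)
    (u : V) (hu : G.degree u = G.maxDegree) :
    (G.induce (G.neighborSet u)).Colorable (r - 1) := by
  classical
  obtain ⟨t, rfl⟩ := Nat.exists_eq_add_of_le' hr
  have hcard : Fintype.card (G.neighborSet u) = G.maxDegree := by
    rw [G.card_neighborSet_eq_degree, hu]
  rcases isEmpty_or_nonempty (G.neighborSet u) with hempty | hne
  · exact .of_isEmpty ..
  apply SimpleGraph.colorable_of_cliqueFree_lt_minDegree (hfree.induce_neighborSet u)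
  obtain ⟨v, hv⟩ := (G.induce (G.neighborSet u)).exists_minimal_degree_vertex
  have hdegree := G.degree_add_card_le_card_add_degree_induce (G.neighborSet u) v
  rw [← hv, hcard] at hdegree
  have hmin := G.minDegree_le_degree v
  have hpos : 0 < G.maxDegree := hcard ▸ Fintype.card_pos
  rw [hcard, Nat.div_lt_iff_lt_mul (by lia)]
  generalize (G.induce (G.neighborSet u)).minDegree = m at *
  have h₁ : 3 * (t + 2) - 4 = 3 * t + 2 := by lia
  have h₂ : 3 * (t + 2) - 1 = 3 * t + 5 := by lia
  rw [show t + 3 - 1 = t + 2 from rfl] at hdeg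
  rw [h₁, h₂]
  have hm : (t + 1) * G.maxDegree ≤ (t + 2) * m := by
    nlinarith [Nat.mul_le_mul_left (t + 2) (Nat.add_le_add_right hmin G.maxDegree),
      Nat.mul_le_mul_left (t + 2) hdegree]
  refine Nat.lt_of_mul_lt_mul_left (a := t + 2) ?_
  nlinarith [Nat.mul_le_mul_right (3 * t + 5) hm]
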